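/- arXiv:2202.07577 — 2 statements merged into one kernel-verified Lean document; each statement's English description precedes it below -/
import Mathlib

section
/- Backward compatibility of wp with angelic weakest preconditions: instantiate the weighted semantics with the Boolean semiring B = ({0,1}, ∨, ∧, 0, 1), regarded as a module over its multiplicative monoid ({0,1}, ∧, 1). Then for every B-wGCL program C, every predicate ψ : Σ → {0,1}, and every state σ, wp[C](ψ)(σ) = 1 if and only if there exists a terminating computation path of the operational semantics starting in configuration (C,σ) whose weight is 1 and whose last state τ satisfies ψ(τ) = 1. -/
/-! ## Monoid modules, natural order, ω-(co)continuity -/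

structure MonModule (M : Type) [Monoid M] (S : Type) where
  add : S → S → S
  zero : S
  smul : M → S → S
  add_assoc : ∀ a b c : S, add (add a b) c = add a (add b c)
  add_comm : ∀ a b : S, add a b = add b a
  add_zero : ∀ a : S, add a zero = a
  smul_assoc : ∀ (u v : M) (a : S), smul (u * v) a = smul u (smul v a)
  smul_add : ∀ (u : M) (a b : S), smul u (add a b) = add (smul u a) (smul u b)
  one_smul : ∀ a : S, smul 1 a = a
  smul_zero : ∀ u : M, smul u zero = zero

namespace MonModule

variable {M S : Type} [Monoid M]

/-- The natural (pre)order: `a ⪯ b` iff `∃ c, a ⊕ c = b`. -/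
def le (mm : MonModule M S) (a b : S) : Prop := ∃ c : S, mm.add a c = b

/-- `S` is naturally ordered if the natural order is antisymmetric (hence a partial order). -/
def NaturallyOrdered (mm : MonModule M S) : Prop :=
  ∀ a b : S, mm.le a b → mm.le b a → a = b

/-- ω-chain (ascending). -/
def Chain (mm : MonModule M S) (s : ℕ → S) : Prop := ∀ n : ℕ, mm.le (s n) (s (n + 1))

/-- ω-descending chain. -/
def DChain (mm : MonModule M S) (s : ℕ → S) : Prop := ∀ n : ℕ, mm.le (s (n + 1)) (s n)

/-- `x` is the supremum (least upper bound) of `s` w.r.t. the natural order. -/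
def IsSup (mm : MonModule M S) (s : ℕ → S) (x : S) : Prop :=
  (∀ n : ℕ, mm.le (s n) x) ∧ ∀ y : S, (∀ n : ℕ, mm.le (s n) y) → mm.le x y

/-- `x` is the infimum (greatest lower bound) of `s` w.r.t. the natural order. -/
def IsInf (mm : MonModule M S) (s : ℕ → S) (x : S) : Prop :=
  (∀ n : ℕ, mm.le x (s n)) ∧ ∀ y : S, (∀ n : ℕ, mm.le y (s n)) → mm.le y x

end MonModule

/-- `S` is ω-continuous: suprema of ω-chains exist (with least element `𝟘`, which is
automatically least for the natural order), and `⊕`, `⊗` are ω-continuous. -/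
structure OmegaContinuous {M S : Type} [Monoid M] (mm : MonModule M S) : Prop where
  sup_exists : ∀ s : ℕ → S, mm.Chain s → ∃ x : S, mm.IsSup s x
  add_cont : ∀ (a : S) (s : ℕ → S) (x : S), mm.Chain s → mm.IsSup s x →
    mm.IsSup (fun n => mm.add a (s n)) (mm.add a x)
  smul_cont : ∀ (u : M) (s : ℕ → S) (x : S), mm.Chain s → mm.IsSup s x →
    mm.IsSup (fun n => mm.smul u (s n)) (mm.smul u x)

/-- `S` is ω-cocontinuous: a greatest element exists, infima of ω-descending chains exist,
and `⊕`, `⊗` are ω-cocontinuous. -/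
structure OmegaCocontinuous {M S : Type} [Monoid M] (mm : MonModule M S) : Prop where
  top_exists : ∃ t : S, ∀ a : S, mm.le a t
  inf_exists : ∀ s : ℕ → S, mm.DChain s → ∃ x : S, mm.IsInf s x
  add_cocont : ∀ (a : S) (s : ℕ → S) (x : S), mm.DChain s → mm.IsInf s x →
    mm.IsInf (fun n => mm.add a (s n)) (mm.add a x)
  smul_cocont : ∀ (u : M) (s : ℕ → S) (x : S), mm.DChain s → mm.IsInf s x →
    mm.IsInf (fun n => mm.smul u (s n)) (mm.smul u x)

def OmegaBicontinuous {M S : Type} [Monoid M] (mm : MonModule M S) : Prop :=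
  OmegaContinuous mm ∧ OmegaCocontinuous mm

/-! ## Weightings (pointwise lifting to `St → S`) -/

section Weightings

variable {M S St : Type} [Monoid M]

/-- Pointwise natural order on weightings. -/
def wle (mm : MonModule M S) (f g : St → S) : Prop := ∀ σ : St, mm.le (f σ) (g σ)

def WChain (mm : MonModule M S) (s : ℕ → St → S) : Prop := ∀ n : ℕ, wle mm (s n) (s (n + 1))

def WDChain (mm : MonModule M S) (s : ℕ → St → S) : Prop := ∀ n : ℕ, wle mm (s (n + 1)) (s n)

def WIsSup (mm : MonModule M S) (s : ℕ → St → S) (x : St → S) : Prop :=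
  (∀ n : ℕ, wle mm (s n) x) ∧ ∀ y : St → S, (∀ n : ℕ, wle mm (s n) y) → wle mm x y

def WIsInf (mm : MonModule M S) (s : ℕ → St → S) (x : St → S) : Prop :=
  (∀ n : ℕ, wle mm x (s n)) ∧ ∀ y : St → S, (∀ n : ℕ, wle mm y (s n)) → wle mm y x

end Weightings

/-! ## wGCL syntax -/

/-- wGCL programs over weights from `M` and program states from `St`:
assignments (as state transformations), sequencing, conditionals, nondeterministic
branching, weighting `⊙ a`, and loops. -/
inductive WGCL (M : Type) (St : Type) : Type
  | assign : (St → St) → WGCL M St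
  | seq : WGCL M St → WGCL M St → WGCL M St
  | ite : Set St → WGCL M St → WGCL M St → WGCL M St
  | branch : WGCL M St → WGCL M St → WGCL M St
  | weight : M → WGCL M St
  | wloop : Set St → WGCL M St → WGCL M St

section Transformers

variable {M S St : Type} [Monoid M]

/-- Iverson-bracket guarding `[φ] ⋄ f`. -/
noncomputable def iv (mm : MonModule M S) (φ : Set St) (f : St → S) : St → S :=
  fun σ => @ite _ (σ ∈ φ) (Classical.propDecidable _) (f σ) mm.zero

/-- Least fixed point of `Φ` w.r.t. the pointwise natural order (chosen by classical choice
if it exists; arbitrary otherwise). -/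
noncomputable def wlfp (mm : MonModule M S) (Φ : (St → S) → St → S) : St → S :=
  @dite _ (∃ x : St → S, Φ x = x ∧ ∀ y : St → S, Φ y = y → wle mm x y)
    (Classical.propDecidable _) (fun h => h.choose) (fun _ => fun _ => mm.zero)

/-- Greatest fixed point of `Φ` w.r.t. the pointwise natural order. -/
noncomputable def wgfp (mm : MonModule M S) (Φ : (St → S) → St → S) : St → S :=
  @dite _ (∃ x : St → S, Φ x = x ∧ ∀ y : St → S, Φ y = y → wle mm y x)
    (Classical.propDecidable _) (fun h => h.choose) (fun _ => fun _ => mm.zero)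

/-- Weakest preweighting transformer `wp`. -/
noncomputable def wp (mm : MonModule M S) : WGCL M St → (St → S) → St → S
  | WGCL.assign g => fun f σ => f (g σ)
  | WGCL.seq C₁ C₂ => fun f => wp mm C₁ (wp mm C₂ f)
  | WGCL.ite φ C₁ C₂ => fun f σ => mm.add (iv mm φ (wp mm C₁ f) σ) (iv mm φᶜ (wp mm C₂ f) σ)
  | WGCL.branch C₁ C₂ => fun f σ => mm.add (wp mm C₁ f σ) (wp mm C₂ f σ)
  | WGCL.weight a => fun f σ => mm.smul a (f σ)
  | WGCL.wloop φ C' => fun f =>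
      wlfp mm (fun X σ => mm.add (iv mm φᶜ f σ) (iv mm φ (wp mm C' X) σ))

/-- The `wp`-characteristic function `Φ_f(X) = [¬φ]⋄f ⊕ [φ]⋄wp[C'](X)` of `while(φ){C'}`. -/
noncomputable def charW (mm : MonModule M S) (φ : Set St) (C' : WGCL M St) (f : St → S)
    (X : St → S) : St → S :=
  fun σ => mm.add (iv mm φᶜ f σ) (iv mm φ (wp mm C' X) σ)

/-- Weakest liberal preweighting transformer `wlp`. -/
noncomputable def wlp (mm : MonModule M S) : WGCL M St → (St → S) → St → S
  | WGCL.assign g => fun f σ => f (g σ)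
  | WGCL.seq C₁ C₂ => fun f => wlp mm C₁ (wlp mm C₂ f)
  | WGCL.ite φ C₁ C₂ => fun f σ => mm.add (iv mm φ (wlp mm C₁ f) σ) (iv mm φᶜ (wlp mm C₂ f) σ)
  | WGCL.branch C₁ C₂ => fun f σ => mm.add (wlp mm C₁ f σ) (wlp mm C₂ f σ)
  | WGCL.weight a => fun f σ => mm.smul a (f σ)
  | WGCL.wloop φ C' => fun f =>
      wgfp mm (fun X σ => mm.add (iv mm φᶜ f σ) (iv mm φ (wlp mm C' X) σ))

/-- The `wlp`-characteristic function `Ψ_f(X) = [¬φ]⋄f ⊕ [φ]⋄wlp[C'](X)` of `while(φ){C'}`. -/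
noncomputable def charWlp (mm : MonModule M S) (φ : Set St) (C' : WGCL M St) (f : St → S)
    (X : St → S) : St → S :=
  fun σ => mm.add (iv mm φᶜ f σ) (iv mm φ (wlp mm C' X) σ)

end Transformers

/-! ## Operational semantics -/

/-- Configurations: `none` is a terminal configuration. -/
abbrev Conf (M St : Type) := Option (WGCL M St) × St

section Operational

variable {M St : Type} [Monoid M]

/-- Weighted small-step operational semantics: each transition carries a weight in `M`
(the weight `a` for executing `⊙ a`, and `1` otherwise). -/
inductive Step : Conf M St → M → Conf M St → Prop
  | assign (g : St → St) (σ : St) : Step (some (WGCL.assign g), σ) 1 (none, g σ)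
  | weight (a : M) (σ : St) : Step (some (WGCL.weight a), σ) a (none, σ)
  | seq_fin {C₁ : WGCL M St} {σ : St} {w : M} {σ' : St} (C₂ : WGCL M St) :
      Step (some C₁, σ) w (none, σ') → Step (some (WGCL.seq C₁ C₂), σ) w (some C₂, σ')
  | seq_step {C₁ : WGCL M St} {σ : St} {w : M} {C₁' : WGCL M St} {σ' : St} (C₂ : WGCL M St) :
      Step (some C₁, σ) w (some C₁', σ') →
      Step (some (WGCL.seq C₁ C₂), σ) w (some (WGCL.seq C₁' C₂), σ')
  | ite_left {φ : Set St} {σ : St} (C₁ C₂ : WGCL M St) :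
      σ ∈ φ → Step (some (WGCL.ite φ C₁ C₂), σ) 1 (some C₁, σ)
  | ite_right {φ : Set St} {σ : St} (C₁ C₂ : WGCL M St) :
      σ ∉ φ → Step (some (WGCL.ite φ C₁ C₂), σ) 1 (some C₂, σ)
  | branch_left (C₁ C₂ : WGCL M St) (σ : St) :
      Step (some (WGCL.branch C₁ C₂), σ) 1 (some C₁, σ)
  | branch_right (C₁ C₂ : WGCL M St) (σ : St) :
      Step (some (WGCL.branch C₁ C₂), σ) 1 (some C₂, σ)
  | loop_enter {φ : Set St} {σ : St} (C : WGCL M St) :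
      σ ∈ φ → Step (some (WGCL.wloop φ C), σ) 1 (some (WGCL.seq C (WGCL.wloop φ C)), σ)
  | loop_exit {φ : Set St} {σ : St} (C : WGCL M St) :
      σ ∉ φ → Step (some (WGCL.wloop φ C), σ) 1 (none, σ)

/-- A finite computation path from configuration `c`, recorded as the list of
(transition weight, successor configuration) pairs. -/
inductive Steps : Conf M St → List (M × Conf M St) → Prop
  | nil (c : Conf M St) : Steps c []
  | cons {c : Conf M St} {w : M} {c' : Conf M St} {l : List (M × Conf M St)} :
      Step c w c' → Steps c' l → Steps c ((w, c') :: l)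

/-- Weight of a computation path: the ordered product of its transition weights. -/
def pathWeight (l : List (M × Conf M St)) : M := (l.map Prod.fst).prod

/-- Final state of a (nonempty) computation path; `σ` for the empty path. -/
def lastState (σ : St) (l : List (M × Conf M St)) : St :=
  (l.getLastD ((1 : M), ((none : Option (WGCL M St)), σ))).2.2

/-- A terminating computation path from `c`: a finite path ending in a terminal
configuration. -/
def TermPath (c : Conf M St) (l : List (M × Conf M St)) : Prop :=
  Steps c l ∧ ∃ p : M × Conf M St, l.getLast? = some p ∧ p.2.1 = (none : Option (WGCL M St))

/-- There is an infinite computation path starting in `c`. -/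
def InfinitePathFrom (c : Conf M St) : Prop :=
  ∃ π : ℕ → Conf M St, π 0 = c ∧ ∀ n : ℕ, ∃ w : M, Step (π n) w (π (n + 1))

end Operational

/-! ## Countable module sums as suprema of finite partial sums -/

section Sums

variable {M S : Type} [Monoid M]

/-- Finite sum of `g` over the elements of a list. -/
def finListSum (mm : MonModule M S) {ι : Type} (g : ι → S) : List ι → S
  | [] => mm.zero
  | i :: t => mm.add (g i) (finListSum mm g t)

/-- `x` is the (countable) module sum `⨁_{i ∈ T} g i`, i.e. the least upper bound
of all finite partial sums over duplicate-free lists of elements of `T`. -/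
def IsSumOver (mm : MonModule M S) {ι : Type} (T : Set ι) (g : ι → S) (x : S) : Prop :=
  (∀ l : List ι, l.Nodup → (∀ i ∈ l, i ∈ T) → mm.le (finListSum mm g l) x) ∧
  ∀ y : S, (∀ l : List ι, l.Nodup → (∀ i ∈ l, i ∈ T) → mm.le (finListSum mm g l) y) → mm.le x y

end Sums

/-- The Boolean semiring `({0,1}, ∨, ∧, 0, 1)` viewed as a module over its multiplicative
monoid `({0,1}, ∧, 1)`: addition is disjunction, the action is conjunction. -/
def boolMM : MonModule Bool Bool where
  add := or
  zero := false
  smul := and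
  add_assoc := by decide
  add_comm := by decide
  add_zero := by decide
  smul_assoc := by decide
  smul_add := by decide
  one_smul := by decide
  smul_zero := by decide

/-- Big-step semantics of Boolean-weighted programs, restricted to executions of weight `1`. -/
inductive BigStep {St : Type} : WGCL Bool St → St → St → Prop
  | assign (g : St → St) (σ : St) : BigStep (WGCL.assign g) σ (g σ)
  | weight (σ : St) : BigStep (WGCL.weight true) σ σ
  | seq {C₁ C₂ : WGCL Bool St} {σ ρ τ : St} :
      BigStep C₁ σ ρ → BigStep C₂ ρ τ → BigStep (WGCL.seq C₁ C₂) σ τ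
  | ite_left {φ : Set St} {C₁ C₂ : WGCL Bool St} {σ τ : St} :
      σ ∈ φ → BigStep C₁ σ τ → BigStep (WGCL.ite φ C₁ C₂) σ τ
  | ite_right {φ : Set St} {C₁ C₂ : WGCL Bool St} {σ τ : St} :
      σ ∉ φ → BigStep C₂ σ τ → BigStep (WGCL.ite φ C₁ C₂) σ τ
  | branch_left {C₁ C₂ : WGCL Bool St} {σ τ : St} :
      BigStep C₁ σ τ → BigStep (WGCL.branch C₁ C₂) σ τ
  | branch_right {C₁ C₂ : WGCL Bool St} {σ τ : St} :
      BigStep C₂ σ τ → BigStep (WGCL.branch C₁ C₂) σ τ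
  | loop_enter {φ : Set St} {C : WGCL Bool St} {σ ρ τ : St} :
      σ ∈ φ → BigStep C σ ρ → BigStep (WGCL.wloop φ C) ρ τ → BigStep (WGCL.wloop φ C) σ τ
  | loop_exit {φ : Set St} {C : WGCL Bool St} {σ : St} :
      σ ∉ φ → BigStep (WGCL.wloop φ C) σ σ

/-- Big-step termination of a configuration in a final state. -/
def ConfTerminates {St : Type} : Conf Bool St → St → Prop
  | (none, σ), τ => σ = τ
  | (some C, σ), τ => BigStep C σ τ

section BooleanSemantics

variable {St : Type}

theorem Step.confTerminates {c c' : Conf Bool St} {w : Bool} (h : Step c w c') (hw : w = true)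
    {τ : St} (h' : ConfTerminates c' τ) : ConfTerminates c τ := by
  induction h generalizing τ with
  | assign g σ => cases h'; exact .assign g σ
  | weight a σ => cases h'; subst hw; exact .weight σ
  | seq_fin C₂ _ ih => exact .seq (ih hw rfl) h'
  | seq_step C₂ _ ih =>
    cases h' with
    | seq h₁ h₂ => exact .seq (ih hw h₁) h₂
  | ite_left C₁ C₂ hφ => exact .ite_left hφ h'
  | ite_right C₁ C₂ hφ => exact .ite_right hφ h'
  | branch_left C₁ C₂ σ => exact .branch_left h'
  | branch_right C₁ C₂ σ => exact .branch_right h'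
  | loop_enter C hφ =>
    cases h' with
    | seq h₁ h₂ => exact .loop_enter hφ h₁ h₂
  | loop_exit C hφ => cases h'; exact .loop_exit hφ

theorem pathWeight_cons_eq_true {w : Bool} {c : Conf Bool St} {l : List (Bool × Conf Bool St)} :
    pathWeight ((w, c) :: l) = true ↔ w = true ∧ pathWeight l = true := by
  simp only [pathWeight, List.map_cons, List.prod_cons]
  exact Bool.and_eq_true_iff

theorem Steps.confTerminates {c : Conf Bool St} {l : List (Bool × Conf Bool St)} (h : Steps c l)
    (hw : pathWeight l = true) {τ : St}
    (hl : (l.getLastD (true, c)).2 = (none, τ)) : ConfTerminates c τ := by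
  induction h with
  | nil c => simp only [List.getLastD_nil] at hl; subst hl; rfl
  | cons hs _ ih =>
    rw [pathWeight_cons_eq_true] at hw
    obtain ⟨rfl, hw⟩ := hw
    rw [List.getLastD_cons] at hl
    exact hs.confTerminates rfl (ih hw hl)

/-- Small-step reachability through transitions of weight `1`. -/
def Reaches : Conf Bool St → Conf Bool St → Prop :=
  Relation.ReflTransGen fun c c' => Step c true c'

theorem Reaches.head {c d e : Conf Bool St} (h : Step c true d) (h' : Reaches d e) : Reaches c e :=
  Relation.ReflTransGen.head h h'

theorem Reaches.seq {c : Conf Bool St} {C₂ : WGCL Bool St} {ρ : St} {d : Conf Bool St}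
    (h : Reaches c (none, ρ)) (h' : Reaches (some C₂, ρ) d) :
    ∀ {C₁ : WGCL Bool St} {σ : St}, c = (some C₁, σ) → Reaches (some (WGCL.seq C₁ C₂), σ) d := by
  induction h using Relation.ReflTransGen.head_induction_on with
  | refl => intro _ _ h; cases h
  | head hs _ ih =>
    rename_i c₁ c₂ _
    rintro C₁ σ rfl
    obtain ⟨_ | C, σ'⟩ := c₂
    · obtain rfl : σ' = ρ := by
        rename_i hr
        rcases Relation.ReflTransGen.cases_head hr with h | ⟨_, h, _⟩
        · exact congrArg Prod.snd h
        · cases h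
      exact .head (.seq_fin C₂ hs) h'
    · exact .head (.seq_step C₂ hs) (ih rfl)

theorem BigStep.reaches {C : WGCL Bool St} {σ τ : St} (h : BigStep C σ τ) :
    Reaches (some C, σ) (none, τ) := by
  induction h with
  | assign g σ => exact .single (.assign g σ)
  | weight σ => exact .single (.weight true σ)
  | seq _ _ ih₁ ih₂ => exact ih₁.seq ih₂ rfl
  | ite_left hφ _ ih => exact ih.head (.ite_left _ _ hφ)
  | ite_right hφ _ ih => exact ih.head (.ite_right _ _ hφ)
  | branch_left _ ih => exact ih.head (.branch_left _ _ _)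
  | branch_right _ ih => exact ih.head (.branch_right _ _ _)
  | loop_enter hφ _ _ ih₁ ih₂ => exact (ih₁.seq ih₂ rfl).head (.loop_enter _ hφ)
  | loop_exit hφ => exact .single (.loop_exit _ hφ)

theorem Reaches.exists_steps {c d : Conf Bool St} (h : Reaches c d) :
    ∃ l, Steps c l ∧ pathWeight l = true ∧ (l.getLastD (true, c)).2 = d := by
  induction h using Relation.ReflTransGen.head_induction_on with
  | refl => exact ⟨[], .nil _, rfl, rfl⟩
  | head hs _ ih =>
    obtain ⟨l, hl, hw, hd⟩ := ih
    refine ⟨_ :: l, .cons hs hl, pathWeight_cons_eq_true.2 ⟨rfl, hw⟩, ?_⟩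
    rwa [List.getLastD_cons]

theorem exists_termPath_iff (C : WGCL Bool St) (ψ : St → Bool) (σ : St) :
    (∃ l : List (Bool × Conf Bool St),
      TermPath (some C, σ) l ∧ pathWeight l = true ∧ ψ (lastState σ l) = true) ↔
    ∃ τ, BigStep C σ τ ∧ ψ τ = true := by
  constructor
  · rintro ⟨l, ⟨hs, ⟨w, o, τ⟩, hp, ho⟩, hw, hψ⟩
    obtain rfl : o = none := ho
    refine ⟨τ, hs.confTerminates (c := (some C, σ)) hw ?_, ?_⟩
    · simp [List.getLastD_eq_getLast?, hp]
    · simpa [lastState, List.getLastD_eq_getLast?, hp] using hψ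
  · rintro ⟨τ, h, hψ⟩
    obtain ⟨l, hs, hw, hl⟩ := h.reaches.exists_steps
    rw [List.getLastD_eq_getLast?] at hl
    cases hp : l.getLast? with
    | none => simp [hp] at hl
    | some p =>
      rw [hp, Option.getD_some] at hl
      refine ⟨l, ⟨hs, p, hp, by rw [hl]⟩, hw, ?_⟩
      simpa [lastState, List.getLastD_eq_getLast?, hp, hl] using hψ

theorem boolMM_le_iff {a b : Bool} : boolMM.le a b ↔ (a = true → b = true) := by
  cases a <;> cases b <;> simp [MonModule.le, boolMM]

theorem boolMM_add_iv_eq_true {φ : Set St} {f g : St → Bool} {σ : St} :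
    boolMM.add (iv boolMM φ f σ) (iv boolMM φᶜ g σ) = true ↔
      (σ ∈ φ ∧ f σ = true) ∨ (σ ∉ φ ∧ g σ = true) := by
  by_cases h : σ ∈ φ <;> simp [iv, boolMM, h]

theorem wlfp_boolMM_eq {Φ : (St → Bool) → St → Bool} {x : St → Bool} (hx : Φ x = x)
    (hle : ∀ y, Φ y = y → wle boolMM x y) : wlfp boolMM Φ = x := by
  have hex : ∃ x, Φ x = x ∧ ∀ y, Φ y = y → wle boolMM x y := ⟨x, hx, hle⟩
  rw [wlfp, dif_pos hex]
  funext σ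
  have h₁ := boolMM_le_iff.1 (hex.choose_spec.2 x hx σ)
  have h₂ := boolMM_le_iff.1 (hle _ hex.choose_spec.1 σ)
  exact Bool.eq_iff_iff.2 ⟨h₁, h₂⟩

theorem BigStep.of_loop_unfold {φ : Set St} {C : WGCL Bool St} {f y : St → Bool}
    (hexit : ∀ σ, σ ∉ φ → f σ = true → y σ = true)
    (henter : ∀ σ ρ, σ ∈ φ → BigStep C σ ρ → y ρ = true → y σ = true)
    {D : WGCL Bool St} {σ τ : St} (h : BigStep D σ τ) (hD : D = WGCL.wloop φ C)
    (hf : f τ = true) : y σ = true := by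
  induction h with
  | loop_enter hφ h₁ _ _ ih => cases hD; exact henter _ _ hφ h₁ (ih rfl hf)
  | loop_exit hφ => cases hD; exact hexit _ hφ hf
  | _ => cases hD

theorem wp_boolMM_eq_true_iff (C : WGCL Bool St) (f : St → Bool) (σ : St) :
    wp boolMM C f σ = true ↔ ∃ τ, BigStep C σ τ ∧ f τ = true := by
  induction C generalizing f σ with
  | assign g =>
    exact ⟨fun h => ⟨_, .assign g σ, h⟩, fun ⟨τ, h, hf⟩ => by cases h; exact hf⟩
  | seq C₁ C₂ ih₁ ih₂ =>
    rw [wp, ih₁]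
    simp only [ih₂]
    constructor
    · rintro ⟨ρ, h₁, τ, h₂, hf⟩
      exact ⟨τ, .seq h₁ h₂, hf⟩
    · rintro ⟨τ, h, hf⟩
      cases h with
      | seq h₁ h₂ => exact ⟨_, h₁, τ, h₂, hf⟩
  | ite φ C₁ C₂ ih₁ ih₂ =>
    rw [wp, boolMM_add_iv_eq_true, ih₁, ih₂]
    constructor
    · rintro (⟨hφ, τ, h, hf⟩ | ⟨hφ, τ, h, hf⟩)
      · exact ⟨τ, .ite_left hφ h, hf⟩
      · exact ⟨τ, .ite_right hφ h, hf⟩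
    · rintro ⟨τ, h, hf⟩
      cases h with
      | ite_left hφ h => exact .inl ⟨hφ, τ, h, hf⟩
      | ite_right hφ h => exact .inr ⟨hφ, τ, h, hf⟩
  | branch C₁ C₂ ih₁ ih₂ =>
    rw [wp, boolMM, Bool.or_eq_true, ← boolMM, ih₁, ih₂]
    constructor
    · rintro (⟨τ, h, hf⟩ | ⟨τ, h, hf⟩)
      · exact ⟨τ, .branch_left h, hf⟩
      · exact ⟨τ, .branch_right h, hf⟩
    · rintro ⟨τ, h, hf⟩
      cases h with
      | branch_left h => exact .inl ⟨τ, h, hf⟩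
      | branch_right h => exact .inr ⟨τ, h, hf⟩
  | weight a =>
    refine (Bool.and_eq_true_iff (x := a) (y := f σ)).trans ⟨?_, ?_⟩
    · rintro ⟨rfl, hf⟩
      exact ⟨σ, .weight σ, hf⟩
    · rintro ⟨τ, h, hf⟩
      cases h
      exact ⟨rfl, hf⟩
  | wloop φ C ih =>
    classical
    have unfold (X : St → Bool) (σ : St) :
        boolMM.add (iv boolMM φᶜ f σ) (iv boolMM φ (wp boolMM C X) σ) = true ↔
          (σ ∈ φ ∧ ∃ ρ, BigStep C σ ρ ∧ X ρ = true) ∨ (σ ∉ φ ∧ f σ = true) := by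
      rw [boolMM.add_comm, boolMM_add_iv_eq_true, ih]
    rw [wp]
    beta_reduce
    rw [wlfp_boolMM_eq
      (x := fun σ => decide (∃ τ, BigStep (WGCL.wloop φ C) σ τ ∧ f τ = true)), decide_eq_true_iff]
    · funext σ
      rw [Bool.eq_iff_iff, unfold]
      simp only [decide_eq_true_iff]
      constructor
      · rintro (⟨hφ, ρ, h, τ, h', hf⟩ | ⟨hφ, hf⟩)
        · exact ⟨τ, .loop_enter hφ h h', hf⟩
        · exact ⟨σ, .loop_exit hφ, hf⟩
      · rintro ⟨τ, h, hf⟩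
        cases h with
        | loop_enter hφ h h' => exact .inl ⟨hφ, _, h, τ, h', hf⟩
        | loop_exit hφ => exact .inr ⟨hφ, hf⟩
    · intro y hy σ
      rw [boolMM_le_iff, decide_eq_true_iff]
      rintro ⟨τ, h, hf⟩
      have key (σ : St) := (unfold y σ).symm.trans (Bool.eq_iff_iff.1 (congrFun hy σ))
      exact h.of_loop_unfold (fun σ hφ hf => (key σ).1 (.inr ⟨hφ, hf⟩))
        (fun σ ρ hφ h hρ => (key σ).1 (.inl ⟨hφ, ρ, h, hρ⟩)) rfl hf

end BooleanSemantics

/-- **Backward compatibility of wp with angelic weakest preconditions**: over the Boolean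
semiring, `wp[C](ψ)(σ) = 1` iff there is a terminating computation path of the operational
semantics starting in `(C,σ)` whose weight is `1` and whose last state `τ` satisfies
`ψ(τ) = 1`. -/
theorem wp_boolean_backward_compatible (St : Type) [Countable St]
    (C : WGCL Bool St) (ψ : St → Bool) (σ : St) :
    wp boolMM C ψ σ = true ↔
      ∃ l : List (Bool × Conf Bool St),
        TermPath (some C, σ) l ∧ pathWeight l = true ∧ ψ (lastState σ l) = true := by
  rw [wp_boolMM_eq_true_iff, exists_termPath_iff]
end

section
/- Absence of infinite paths trivializes the divergence weight: let (M,·,1) be a monoid, S a naturally ordered ω-bicontinuous M-module, C an M-wGCL program, and σ a state such that every computation path of the operational semantics starting in configuration (C,σ) is finite. Then ⨅_{n∈ℕ} ⨁_{π ∈ Paths_n(C,σ)} weight(π) ⊗ ⊤ = 𝟘 (equivalently, wlp[C](𝟘)(σ) = 𝟘), where Paths_n(C,σ) is the set of computation paths of length exactly n from (C,σ). (The proof uses Kőnig's infinity lemma, since the computation tree is finitely branching, so finiteness of all paths forces Paths_n(C,σ) = ∅ for all sufficiently large n.) -/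
section Sums

variable {M S : Type} [Monoid M] {ι : Type}

theorem MonModule.zero_le (mm : MonModule M S) (a : S) : mm.le mm.zero a :=
  ⟨a, by rw [mm.add_comm, mm.add_zero]⟩

theorem MonModule.le_refl (mm : MonModule M S) (a : S) : mm.le a a :=
  ⟨mm.zero, mm.add_zero a⟩

theorem finListSum_perm (mm : MonModule M S) (g : ι → S) {l l' : List ι} (h : l.Perm l') :
    finListSum mm g l = finListSum mm g l' := by
  induction h with
  | nil => rfl
  | cons i _ ih => simp only [finListSum, ih]
  | swap i j l =>
    simp only [finListSum]
    rw [← mm.add_assoc, ← mm.add_assoc, mm.add_comm (g j)]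
  | trans _ _ ih₁ ih₂ => exact ih₁.trans ih₂

theorem finListSum_le_of_sublist (mm : MonModule M S) (g : ι → S) {l l' : List ι}
    (h : l.Sublist l') : mm.le (finListSum mm g l) (finListSum mm g l') := by
  induction h with
  | slnil => exact mm.le_refl _
  | cons i _ ih =>
    obtain ⟨c, hc⟩ := ih
    exact ⟨mm.add (g i) c, by
      rw [finListSum, ← hc, ← mm.add_assoc, mm.add_comm _ (g i), mm.add_assoc]⟩
  | cons_cons i _ ih =>
    obtain ⟨c, hc⟩ := ih
    exact ⟨c, by rw [finListSum, finListSum, ← hc, mm.add_assoc]⟩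

theorem isSumOver_toList (mm : MonModule M S) {T : Set ι} (hT : T.Finite) (g : ι → S) :
    IsSumOver mm T g (finListSum mm g hT.toFinset.toList) := by
  constructor
  · intro l hl hlT
    have hsub : l ⊆ hT.toFinset.toList := fun i hi => by simpa using hlT i hi
    obtain ⟨l', hperm, hl'⟩ := hl.subperm hsub
    rw [← finListSum_perm mm g hperm]
    exact finListSum_le_of_sublist mm g hl'
  · intro y hy
    exact hy _ (Finset.nodup_toList _) fun i hi => by simpa using hi

end Sums

section Termination

variable {M St : Type} [Monoid M]

/-- One step of the operational semantics, forgetting the weight. -/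
def Reduces (c c' : Conf M St) : Prop := ∃ w : M, Step c w c'

/-- Strong normalization of a configuration. -/
def Terminates (c : Conf M St) : Prop := Acc (fun c' c : Conf M St => Reduces c c') c

theorem terminates_of_not_infinitePathFrom {c : Conf M St} (h : ¬ InfinitePathFrom c) :
    Terminates c := by
  by_contra hc
  have hnext : ∀ d : {d : Conf M St // ¬ Terminates d},
      ∃ d' : {d : Conf M St // ¬ Terminates d}, Reduces d.1 d'.1 := by
    rintro ⟨d, hd⟩
    by_contra! hno
    exact hd ⟨_, fun d' hd' => by
      by_contra hd''
      exact hno ⟨d', hd''⟩ hd'⟩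
  choose next hstep using hnext
  refine h ⟨fun n => (next^[n] ⟨c, hc⟩).1, rfl, fun n => ?_⟩
  simp only [Function.iterate_succ_apply']
  exact hstep _

theorem not_step_none {σ : St} {w : M} {c : Conf M St} : ¬ Step (none, σ) w c := nofun

theorem terminates_none (σ : St) : Terminates ((none, σ) : Conf M St) :=
  ⟨_, fun _ ⟨_, h⟩ => (not_step_none h).elim⟩

theorem Terminates.of_reduces {c c' : Conf M St} (h : Terminates c) (hc : Reduces c c') :
    Terminates c' := h.inv hc

theorem Terminates.of_reflTransGen {c c' : Conf M St} (h : Terminates c)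
    (hc : Relation.ReflTransGen Reduces c c') : Terminates c' := by
  induction hc with
  | refl => exact h
  | tail _ hr ih => exact ih.of_reduces hr

theorem Terminates.of_seq {C₁ C₂ : WGCL M St} {σ : St}
    (h : Terminates (some (WGCL.seq C₁ C₂), σ)) : Terminates (some C₁, σ) := by
  generalize hc : ((some (WGCL.seq C₁ C₂), σ) : Conf M St) = c at h
  induction h generalizing C₁ σ with
  | intro c _ ih =>
    subst hc
    refine ⟨_, ?_⟩
    rintro ⟨_ | C₁', σ'⟩ ⟨w, hw⟩
    · exact terminates_none σ'
    · exact ih _ ⟨w, Step.seq_step C₂ hw⟩ rfl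

theorem reflTransGen_seq {C₁ : WGCL M St} (C₂ : WGCL M St) {σ σ' : St}
    (h : Relation.ReflTransGen Reduces (some C₁, σ) (none, σ')) :
    Relation.ReflTransGen Reduces ((some (WGCL.seq C₁ C₂), σ) : Conf M St) (some C₂, σ') := by
  generalize hc : ((some C₁, σ) : Conf M St) = c at h
  induction h using Relation.ReflTransGen.head_induction_on generalizing C₁ σ with
  | refl => simp at hc
  | head hstep _ ih =>
    subst hc
    rename_i d hd
    obtain ⟨_ | C₁', τ⟩ := d
    · obtain ⟨w, hw⟩ := hstep
      obtain heq | ⟨e, ⟨v, hv⟩, -⟩ := hd.cases_head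
      · obtain rfl : τ = σ' := by simpa using heq
        exact .single ⟨w, Step.seq_fin C₂ hw⟩
      · exact (not_step_none hv).elim
    · obtain ⟨w, hw⟩ := hstep
      exact .head ⟨w, Step.seq_step C₂ hw⟩ (ih rfl)

theorem finite_setOf_step (c : Conf M St) : {p : M × Conf M St | Step c p.1 p.2}.Finite := by
  obtain ⟨_ | C, σ⟩ := c
  · exact Set.finite_empty.subset fun _ h => (not_step_none h).elim
  induction C with
  | assign g =>
    refine (Set.finite_singleton (1, (none, g σ))).subset ?_
    rintro ⟨w, c'⟩ (h : Step _ _ _)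
    cases h; rfl
  | weight a =>
    refine (Set.finite_singleton (a, (none, σ))).subset ?_
    rintro ⟨w, c'⟩ (h : Step _ _ _)
    cases h; rfl
  | seq C₁ C₂ ih _ =>
    refine (ih.image fun p => (p.1, (some (p.2.1.elim C₂ fun C => .seq C C₂), p.2.2))).subset ?_
    rintro ⟨w, c'⟩ (h : Step _ _ _)
    cases h with
    | @seq_fin _ _ _ σ' _ h => exact ⟨(w, (none, σ')), h, rfl⟩
    | @seq_step _ _ _ C₁' σ' _ h => exact ⟨(w, (some C₁', σ')), h, rfl⟩
  | ite φ C₁ C₂ =>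
    refine (Set.toFinite {(1, (some C₁, σ)), (1, (some C₂, σ))}).subset ?_
    rintro ⟨w, c'⟩ (h : Step _ _ _)
    cases h
    exacts [.inl rfl, .inr rfl]
  | branch C₁ C₂ =>
    refine (Set.toFinite {(1, (some C₁, σ)), (1, (some C₂, σ))}).subset ?_
    rintro ⟨w, c'⟩ (h : Step _ _ _)
    cases h
    exacts [.inl rfl, .inr rfl]
  | wloop φ C =>
    refine (Set.toFinite {(1, (some (.seq C (.wloop φ C)), σ)), (1, (none, σ))}).subset ?_
    rintro ⟨w, c'⟩ (h : Step _ _ _)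
    cases h
    exacts [.inl rfl, .inr rfl]

theorem finite_setOf_steps (c : Conf M St) (n : ℕ) : {l | Steps c l ∧ l.length = n}.Finite := by
  induction n generalizing c with
  | zero =>
    exact (Set.finite_singleton []).subset fun l hl => List.eq_nil_of_length_eq_zero hl.2
  | succ n ih =>
    refine ((finite_setOf_step c).biUnion fun p _ => (ih p.2).image (p :: ·)).subset ?_
    rintro l ⟨hl, hn⟩
    cases hl with
    | nil => simp at hn
    | cons hstep hl =>
      exact Set.mem_biUnion hstep ⟨_, ⟨hl, by simpa using hn⟩, rfl⟩

theorem Terminates.exists_length_lt {c : Conf M St} (h : Terminates c) :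
    ∃ N : ℕ, ∀ l, Steps c l → l.length < N := by
  induction h with
  | intro c _ ih =>
    choose! N hN using ih
    obtain ⟨B, hB⟩ := ((finite_setOf_step c).image fun p => N p.2).bddAbove
    refine ⟨B + 1, fun l hl => ?_⟩
    cases hl with
    | nil => simp
    | cons hstep hl =>
      have h₁ := hN _ ⟨_, hstep⟩ _ hl
      have h₂ := hB ⟨(_, _), hstep, rfl⟩
      simp only [List.length_cons] at h₂ ⊢
      omega

end Termination

section Wlp

variable {M S St : Type} [Monoid M]

theorem add_iv_compl_eq_zero (mm : MonModule M S) {φ : Set St} {f g : St → S} {σ : St}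
    (hf : σ ∈ φ → f σ = mm.zero) (hg : σ ∉ φ → g σ = mm.zero) :
    mm.add (iv mm φ f σ) (iv mm φᶜ g σ) = mm.zero := by
  by_cases h : σ ∈ φ <;> simp [iv, h, hf, hg, mm.add_zero]

theorem wgfp_eq_zero_or_fixed (mm : MonModule M S) (Φ : (St → S) → St → S) :
    (wgfp mm Φ = fun _ => mm.zero) ∨ Φ (wgfp mm Φ) = wgfp mm Φ := by
  unfold wgfp
  split_ifs with h
  · exact .inr h.choose_spec.1
  · exact .inl rfl

/-- On a terminating configuration, `wlp` vanishes as soon as the postweighting vanishes on all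
reachable final states. -/
theorem wlp_eq_zero_of_terminates (mm : MonModule M S) (C : WGCL M St) (f : St → S) (σ : St)
    (hC : Terminates (some C, σ))
    (hf : ∀ τ, Relation.ReflTransGen Reduces ((some C, σ) : Conf M St) (none, τ) →
      f τ = mm.zero) :
    wlp mm C f σ = mm.zero := by
  induction C generalizing f σ with
  | assign g => exact hf _ (.single ⟨1, .assign g σ⟩)
  | weight a =>
    simp only [wlp]
    rw [hf _ (.single ⟨a, .weight a σ⟩), mm.smul_zero]
  | seq C₁ C₂ ih₁ ih₂ =>
    refine ih₁ _ _ hC.of_seq fun τ hτ => ?_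
    have hseq := reflTransGen_seq C₂ hτ
    exact ih₂ _ _ (hC.of_reflTransGen hseq) fun ρ hρ => hf ρ (hseq.trans hρ)
  | ite φ C₁ C₂ ih₁ ih₂ =>
    refine add_iv_compl_eq_zero mm (fun h => ?_) (fun h => ?_)
    · have hr : Reduces ((some (.ite φ C₁ C₂), σ) : Conf M St) _ := ⟨1, .ite_left C₁ C₂ h⟩
      exact ih₁ _ _ (hC.of_reduces hr) fun τ hτ => hf τ (.head hr hτ)
    · have hr : Reduces ((some (.ite φ C₁ C₂), σ) : Conf M St) _ := ⟨1, .ite_right C₁ C₂ h⟩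
      exact ih₂ _ _ (hC.of_reduces hr) fun τ hτ => hf τ (.head hr hτ)
  | branch C₁ C₂ ih₁ ih₂ =>
    have hl : Reduces ((some (.branch C₁ C₂), σ) : Conf M St) _ := ⟨1, .branch_left C₁ C₂ σ⟩
    have hr : Reduces ((some (.branch C₁ C₂), σ) : Conf M St) _ := ⟨1, .branch_right C₁ C₂ σ⟩
    simp only [wlp]
    rw [ih₁ _ _ (hC.of_reduces hl) fun τ hτ => hf τ (.head hl hτ),
      ih₂ _ _ (hC.of_reduces hr) fun τ hτ => hf τ (.head hr hτ), mm.add_zero]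
  | wloop φ C ih =>
    simp only [wlp]
    set Ψ : (St → S) → St → S :=
      fun X σ => mm.add (iv mm φᶜ f σ) (iv mm φ (wlp mm C X) σ) with hΨ
    obtain hzero | hfix := wgfp_eq_zero_or_fixed mm Ψ
    · rw [hzero]
    have hacc := Acc.transGen hC
    generalize hc : ((some (WGCL.wloop φ C), σ) : Conf M St) = c at hacc
    induction hacc generalizing σ with
    | intro c _ ihc =>
      subst hc
      rw [← hfix]
      simp only [hΨ]
      rw [mm.add_comm]
      refine add_iv_compl_eq_zero mm (fun h => ?_) (fun h => ?_)
      · have hr : Reduces ((some (.wloop φ C), σ) : Conf M St) _ := ⟨1, .loop_enter C h⟩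
        refine ih _ _ (hC.of_reduces hr).of_seq fun τ hτ => ?_
        have hseq := reflTransGen_seq (WGCL.wloop φ C) hτ
        have htrans := Relation.TransGen.head' hr hseq
        exact ihc _ (Relation.transGen_swap.mpr htrans) τ (hC.of_reflTransGen htrans.to_reflTransGen)
          (fun ρ hρ => hf ρ (htrans.to_reflTransGen.trans hρ)) rfl
      · exact hf _ (.single ⟨1, .loop_exit C h⟩)

end Wlp

/-- **Absence of infinite paths trivializes the divergence weight**: if `S` is a naturally
ordered ω-bicontinuous `M`-module and every computation path from `(C,σ)` is finite (there
is no infinite computation path), then `⨅_{n} ⨁_{π ∈ Paths_n(C,σ)} weight(π) ⊗ ⊤ = 𝟘`,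
equivalently `wlp[C](𝟘)(σ) = 𝟘`. -/
theorem no_infinite_paths_wlp_zero (M S St : Type) [Monoid M] [Countable St]
    (mm : MonModule M S) (hord : mm.NaturallyOrdered) (hbi : OmegaBicontinuous mm)
    (C : WGCL M St) (σ : St)
    (hfin : ¬ InfinitePathFrom (M := M) (St := St) (some C, σ)) :
    (∀ top : S, (∀ a : S, mm.le a top) →
      ∃ v : ℕ → S,
        (∀ n : ℕ,
          IsSumOver mm {l : List (M × Conf M St) | Steps (some C, σ) l ∧ l.length = n}
            (fun l => mm.smul (pathWeight l) top) (v n)) ∧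
        mm.IsInf v mm.zero) ∧
    wlp mm C (fun _ => mm.zero) σ = mm.zero := by
  have hterm := terminates_of_not_infinitePathFrom hfin
  refine ⟨fun top _ => ?_, wlp_eq_zero_of_terminates mm C _ σ hterm fun _ _ => rfl⟩
  have hsum (n : ℕ) := isSumOver_toList mm (finite_setOf_steps (some C, σ) n)
    (fun l => mm.smul (pathWeight l) top)
  refine ⟨_, hsum, fun n => mm.zero_le _, fun y hy => ?_⟩
  obtain ⟨N, hN⟩ := hterm.exists_length_lt
  have hempty : (finite_setOf_steps (some C, σ) N).toFinset = ∅ := by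
    ext l
    simpa using fun hl => (hN l hl).ne
  simpa [hempty, finListSum] using hy N
end
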